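/- arXiv:1406.5895 — 3 statements merged into one kernel-verified Lean document; each statement's English description precedes it below -/
import Mathlib

section
/- For every n > 2, the Jackson graph J(n) is connected, every vertex has indegree 2 and outdegree 2, and consequently J(n) admits an Eulerian cycle (a closed walk traversing every edge exactly once). -/
/-- The vertices of the Jackson graph of degree `n` : words over `Σ_n` consisting of
`n - 2` pairwise distinct letters. -/
abbrev JacksonVertex (n : ℕ) : Type :=
  {u : List (Fin n) // u.length = n - 2 ∧ u.Nodup}

/-- The edges of the Jackson graph of degree `n` : there is an edge from `u` to `v` iff
the suffix of length `n - 3` of `u` equals the prefix of length `n - 3` of `v` and the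
first letter of `u` differs from the last letter of `v`. -/
def JacksonEdge {n : ℕ} (u v : JacksonVertex n) : Prop :=
  u.val.drop (u.val.length - (n - 3)) = v.val.take (n - 3) ∧
  u.val.head? ≠ v.val.getLast?

/-- `c` is an Eulerian cycle for the edge relation `E` : a closed walk (given by the
cyclic sequence of its vertices) all of whose steps are edges and which traverses every
edge exactly once. -/
def IsEulerianCycle {V : Type*} [DecidableEq V] (E : V → V → Prop) (c : List V) : Prop :=
  c ≠ [] ∧ (∀ p ∈ c.zip (c.rotate 1), E p.1 p.2) ∧
    ∀ a b : V, E a b → (c.zip (c.rotate 1)).count (a, b) = 1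

open Equiv in
/-- Merging two cycles of a permutation. -/
theorem merge_cycles {α : Type*} [Finite α] [DecidableEq α] (π : Perm α) (e f : α)
    (h : ¬ π.SameCycle e f) :
    (π * swap e f).SameCycle e f ∧ ∀ x, π.SameCycle e x → (π * swap e f).SameCycle e x := by
  set ρ := π * swap e f with hρ
  have he : ρ e = π f := by simp [hρ]
  have hf : ρ f = π e := by simp [hρ]
  have ho : ∀ x, x ≠ e → x ≠ f → ρ x = π x := by
    intro x h1 h2
    simp [hρ, swap_apply_of_ne_of_ne h1 h2]
  have h1 : ∀ k : ℕ, ρ.SameCycle e ((π ^ (k + 1)) f) := by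
    intro k
    induction k with
    | zero =>
      have : ρ.SameCycle e (ρ e) := Perm.sameCycle_apply_right.2 (Perm.SameCycle.refl _ _)
      simpa [he] using this
    | succ k ih =>
      set x := (π ^ (k + 1)) f with hx
      have hx' : (π ^ (k + 1 + 1)) f = π x := by rw [pow_succ', Perm.mul_apply]
      rw [hx']
      by_cases hxe : x = e
      · exact absurd (Perm.SameCycle.symm ⟨(k + 1 : ℕ), by rw [zpow_natCast, ← hx, hxe]⟩) h
      by_cases hxf : x = f
      · rw [hxf, ← he]
        exact Perm.sameCycle_apply_right.2 (Perm.SameCycle.refl _ _)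
      · rw [← ho x hxe hxf]
        exact Perm.sameCycle_apply_right.2 ih
  have hef : ρ.SameCycle e f := by
    have := h1 (orderOf π - 1)
    rwa [Nat.sub_add_cancel (orderOf_pos π), pow_orderOf_eq_one] at this
  refine ⟨hef, ?_⟩
  have h2 : ∀ k : ℕ, ρ.SameCycle e ((π ^ k) e) := by
    intro k
    induction k with
    | zero => exact Perm.SameCycle.refl _ _
    | succ k ih =>
      set x := (π ^ k) e with hx
      have hx' : (π ^ (k + 1)) e = π x := by rw [pow_succ', Perm.mul_apply]
      rw [hx']
      by_cases hxf : x = f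
      · exact absurd ⟨(k : ℕ), by rw [zpow_natCast, ← hx, hxf]⟩ h
      by_cases hxe : x = e
      · rw [hxe, ← hf]
        exact Perm.sameCycle_apply_right.2 hef
      · rw [← ho x hxe hxf]
        exact Perm.sameCycle_apply_right.2 ih
  intro x hx
  obtain ⟨k, rfl⟩ := hx.exists_nat_pow_eq
  exact h2 k

/-- A strongly connected balanced finite digraph with an edge is Eulerian. -/
theorem euler_aux {V : Type*} [Finite V] [DecidableEq V] (E : V → V → Prop)
    (conn : ∀ u v, Relation.ReflTransGen E u v)
    (deg : ∀ v, {u | E u v}.ncard = {w | E v w}.ncard)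
    (hE : ∃ a b, E a b) : ∃ c, IsEulerianCycle E c := by
  classical
  let Ed := {p : V × V // E p.1 p.2}
  have hloc : ∀ v, Nonempty ({e : Ed // e.1.2 = v} ≃ {e : Ed // e.1.1 = v}) := by
    intro v
    let i1 : {e : Ed // e.1.2 = v} ≃ {u | E u v} :=
      { toFun := fun e => ⟨e.1.1.1, by have := e.1.2; rw [e.2] at this; exact this⟩
        invFun := fun u => ⟨⟨(u.1, v), u.2⟩, rfl⟩
        left_inv := by rintro ⟨⟨⟨a, b⟩, h⟩, rfl⟩; rfl
        right_inv := by rintro ⟨a, h⟩; rfl }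
    let i2 : {e : Ed // e.1.1 = v} ≃ {u | E v u} :=
      { toFun := fun e => ⟨e.1.1.2, by have := e.1.2; rw [e.2] at this; exact this⟩
        invFun := fun u => ⟨⟨(v, u.1), u.2⟩, rfl⟩
        left_inv := by rintro ⟨⟨⟨a, b⟩, h⟩, rfl⟩; rfl
        right_inv := by rintro ⟨a, h⟩; rfl }
    have : Nonempty ({u | E u v} ≃ {u | E v u}) := by
      rw [← Finite.card_eq]
      exact deg v
    exact this.elim fun j => ⟨i1.trans (j.trans i2.symm)⟩
  let loc := fun v => Classical.choice (hloc v)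
  let π0 : Equiv.Perm Ed :=
    (Equiv.sigmaFiberEquiv (fun e : Ed => e.1.2)).symm.trans
      ((Equiv.sigmaCongrRight loc).trans (Equiv.sigmaFiberEquiv (fun e : Ed => e.1.1)))
  have hπ0 : ∀ e : Ed, (π0 e).1.1 = e.1.2 := fun e => (loc e.1.2 ⟨e, rfl⟩).2
  obtain ⟨a, b, hab⟩ := hE
  let e0 : Ed := ⟨(a, b), hab⟩
  have : Nonempty {π : Equiv.Perm Ed // ∀ e : Ed, (π e).1.1 = e.1.2} := ⟨⟨π0, hπ0⟩⟩
  obtain ⟨⟨π, hπ⟩, hmax⟩ := Finite.exists_max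
    (fun π : {π : Equiv.Perm Ed // ∀ e : Ed, (π e).1.1 = e.1.2} =>
      {x | π.1.SameCycle e0 x}.ncard)
  -- the orbit is closed under succession
  have hclosed : ∀ e f : Ed, π.SameCycle e0 e → f.1.1 = e.1.2 → π.SameCycle e0 f := by
    intro e f he hf
    by_contra hcon
    set g := π.symm f with hg
    have hgf : π g = f := by simp [hg]
    have hg1 : g.1.2 = e.1.2 := by rw [← hf, ← hgf, hπ]
    have hng : ¬ π.SameCycle e g := by
      intro h
      apply hcon
      rw [← hgf]
      exact Equiv.Perm.sameCycle_apply_right.2 (he.trans h)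
    obtain ⟨m1, m2⟩ := merge_cycles π e g hng
    have hρ : ∀ x : Ed, ((π * Equiv.swap e g) x).1.1 = x.1.2 := by
      intro x
      rw [Equiv.Perm.mul_apply, hπ]
      by_cases h1 : x = e
      · rw [h1, Equiv.swap_apply_left, hg1]
      by_cases h2 : x = g
      · rw [h2, Equiv.swap_apply_right, hg1]
      rw [Equiv.swap_apply_of_ne_of_ne h1 h2]
    have hm := hmax ⟨π * Equiv.swap e g, hρ⟩
    have hlt : {x | π.SameCycle e0 x}.ncard < {x | (π * Equiv.swap e g).SameCycle e0 x}.ncard := by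
      apply Set.ncard_lt_ncard _ (Set.toFinite _)
      have h0 := m2 e0 he.symm
      refine ⟨fun x hx => h0.symm.trans (m2 x (he.symm.trans hx)), fun hsub => ?_⟩
      exact hng (he.symm.trans (hsub (h0.symm.trans m1)))
    exact absurd hm (not_le.2 hlt)
  have hreach : ∀ v, Relation.ReflTransGen E b v →
      ∃ e : Ed, π.SameCycle e0 e ∧ e.1.2 = v := by
    intro v hv
    induction hv with
    | refl => exact ⟨e0, Equiv.Perm.SameCycle.refl _ _, rfl⟩
    | tail _ h ih =>
      obtain ⟨e, he, hev⟩ := ih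
      exact ⟨⟨(_, _), h⟩, hclosed e _ he hev.symm, rfl⟩
  have hall : ∀ f : Ed, π.SameCycle e0 f := by
    intro f
    obtain ⟨e, he, hev⟩ := hreach f.1.1 (conn _ _)
    exact hclosed e f he hev.symm
  set N := Function.minimalPeriod π e0 with hN
  have hNpos : 0 < N := by
    apply Function.minimalPeriod_pos_of_mem_periodicPts
    exact π.injective.mem_periodicPts e0
  let c : List V := (List.range N).map (fun i => (π^[i] e0).1.1)
  have hzip : c.zip (c.rotate 1) = (List.range N).map (fun i => (π^[i] e0).1) := by
    apply List.ext_getElem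
    · simp [c]
    · intro i h1 h2
      have hi : i < N := by simpa using h2
      simp only [c, List.getElem_zip, List.getElem_rotate, List.getElem_map, List.getElem_range,
        List.length_map, List.length_range]
      rw [hN, Function.iterate_mod_minimalPeriod_eq, Function.iterate_succ_apply', hπ]
  refine ⟨c, ?_, ?_, ?_⟩
  · intro h
    have := congrArg List.length h
    simp [c] at this
    omega
  · rw [hzip]
    intro p hp
    obtain ⟨i, _, rfl⟩ := List.mem_map.1 hp
    exact (π^[i] e0).2
  · intro x y hxy
    rw [hzip]
    apply List.count_eq_one_of_mem
    · apply List.Nodup.map_on _ List.nodup_range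
      intro i hi j hj hij
      exact Function.iterate_injOn_Iio_minimalPeriod (by simpa using hi) (by simpa using hj)
        (Subtype.ext hij)
    · obtain ⟨k, hk⟩ := (hall ⟨(x, y), hxy⟩).exists_nat_pow_eq
      refine List.mem_map.2 ⟨k % N, by simpa using Nat.mod_lt _ hNpos, ?_⟩
      rw [hN, Function.iterate_mod_minimalPeriod_eq, ← Equiv.Perm.coe_pow, hk]

theorem edge_out {n : ℕ} (hn : 2 < n) (u v : JacksonVertex n) :
    JacksonEdge u v ↔ ∃ c, c ∉ u.val ∧ v.val = u.val.tail ++ [c] := by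
  obtain ⟨u, hu, hu'⟩ := u
  obtain ⟨v, hv, hv'⟩ := v
  obtain ⟨a, w, rfl⟩ := List.exists_cons_of_length_pos (l := u) (by omega)
  obtain ⟨w', c, rfl⟩ : ∃ w' c, v = w' ++ [c] := by
    rcases List.eq_nil_or_concat v with rfl | ⟨w', c, rfl⟩
    · simp at hv; omega
    · exact ⟨w', c, by simp⟩
  simp only [List.length_cons, List.length_append, List.length_nil] at hu hv
  have h1 : w.length + 1 - (n - 3) = 1 := by omega
  have h2 : n - 3 = w'.length := by omega
  simp only [JacksonEdge, List.length_cons, h1]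
  rw [h2]
  simp only [List.drop_succ_cons, List.drop_zero, List.take_left', List.head?_cons,
    List.getLast?_append, List.getLast?_singleton, List.tail_cons]
  simp only [Option.some_or, ne_eq, Option.some.injEq]
  constructor
  · rintro ⟨rfl, h⟩
    refine ⟨c, ?_, rfl⟩
    simp [List.nodup_append] at hv'
    simp only [List.mem_cons, not_or]
    exact ⟨fun h' => h h'.symm, fun h' => hv'.2 _ h' rfl⟩
  · rintro ⟨d, hd, h⟩
    obtain ⟨rfl, h'⟩ := List.append_inj' h rfl
    simp at h'
    subst h'
    simp at hd
    exact ⟨rfl, fun h' => hd.1 h'.symm⟩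

theorem edge_in {n : ℕ} (hn : 2 < n) (u v : JacksonVertex n) :
    JacksonEdge u v ↔ ∃ c, c ∉ v.val ∧ u.val = c :: v.val.dropLast := by
  rw [edge_out hn]
  obtain ⟨u, hu, hu'⟩ := u
  obtain ⟨v, hv, hv'⟩ := v
  constructor
  · rintro ⟨c, hc, h⟩
    obtain ⟨a, w, rfl⟩ := List.exists_cons_of_length_pos (l := u) (by omega)
    simp only [List.tail_cons] at h
    subst h
    refine ⟨a, ?_, by simp⟩
    simp at hc hu' ⊢
    exact ⟨hu'.1, fun h => hc.1 h.symm⟩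
  · rintro ⟨a, ha, h⟩
    rcases List.eq_nil_or_concat v with rfl | ⟨w, c, rfl⟩
    · simp at hv; omega
    · simp at h
      subst h
      refine ⟨c, ?_, by simp⟩
      simp at ha hv' ⊢
      simp [List.nodup_append] at hv'
      exact ⟨fun h => ha.2 h.symm, fun h => hv'.2 _ h rfl⟩

theorem missing {n : ℕ} (hn : 2 < n) (u : JacksonVertex n) : {c | c ∉ u.val}.ncard = 2 := by
  have h1 : {c | c ∉ u.val} = ((u.val.toFinset)ᶜ : Finset (Fin n)) := by
    ext; simp
  rw [h1, Set.ncard_coe_finset, Finset.card_compl, List.toFinset_card_of_nodup u.2.2, u.2.1,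
    Fintype.card_fin]
  omega

theorem outdeg {n : ℕ} (hn : 2 < n) (u : JacksonVertex n) : {v | JacksonEdge u v}.ncard = 2 := by
  rw [← missing hn u, ← Set.ncard_image_of_injective _ Subtype.val_injective,
    ← Set.ncard_image_of_injective (f := fun c => u.val.tail ++ [c]) {c | c ∉ u.val}
      (by intro a b h; simpa using h)]
  congr 1
  ext l
  simp only [Set.mem_image, Set.mem_ofPred_eq, edge_out hn]
  constructor
  · rintro ⟨v, ⟨c, hc, h⟩, rfl⟩
    exact ⟨c, hc, h.symm⟩
  · rintro ⟨c, hc, rfl⟩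
    refine ⟨⟨u.val.tail ++ [c], ?_, ?_⟩, ⟨c, hc, rfl⟩, rfl⟩
    · have := u.2.1
      simp; omega
    · have h1 := u.2.2.sublist (List.tail_sublist _)
      rw [List.nodup_append]
      refine ⟨h1, by simp, ?_⟩
      intro a ha b hb hab
      simp at hb
      subst hb; subst hab
      exact hc (List.mem_of_mem_tail ha)

theorem indeg {n : ℕ} (hn : 2 < n) (v : JacksonVertex n) : {u | JacksonEdge u v}.ncard = 2 := by
  rw [← missing hn v, ← Set.ncard_image_of_injective _ Subtype.val_injective,
    ← Set.ncard_image_of_injective (f := fun c => c :: v.val.dropLast) {c | c ∉ v.val}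
      (by intro a b h; simpa using h)]
  congr 1
  ext l
  simp only [Set.mem_image, Set.mem_ofPred_eq, edge_in hn]
  constructor
  · rintro ⟨v, ⟨c, hc, h⟩, rfl⟩
    exact ⟨c, hc, h.symm⟩
  · rintro ⟨c, hc, rfl⟩
    refine ⟨⟨c :: v.val.dropLast, ?_, ?_⟩, ⟨c, hc, rfl⟩, rfl⟩
    · have := v.2.1
      simp; omega
    · have h1 := v.2.2.sublist (List.dropLast_sublist _)
      exact List.nodup_cons.2 ⟨fun h => hc (List.mem_of_mem_dropLast h), h1⟩

/-- The vertex given by the first `m + 1` letters of a permutation. -/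
def permVertex {m : ℕ} (p : Equiv.Perm (Fin (m + 3))) : JacksonVertex (m + 3) :=
  ⟨List.ofFn (fun i : Fin (m + 1) => p (i.castLE (by omega))), by simp, by
    rw [List.nodup_ofFn]
    intro i j h
    simpa using h⟩

theorem permVertex_surj {m : ℕ} (u : JacksonVertex (m + 3)) : ∃ p, permVertex p = u := by
  classical
  have hl : u.val.length = m + 1 := u.2.1
  let f : Fin (m + 1) → Fin (m + 3) := fun i => u.val[i.val]'(by omega)
  have hf : Function.Injective f := by
    intro i j h
    have := (List.Nodup.getElem_inj_iff u.2.2).1 h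
    exact Fin.ext this
  let g : Fin (m + 1) → Fin (m + 3) := Fin.castLE (by omega)
  have hg : Function.Injective g := Fin.castLE_injective _
  obtain ⟨p, hp⟩ := Equiv.Perm.exists_extending_pair g f hg hf
  refine ⟨p, Subtype.ext ?_⟩
  apply List.ext_getElem
  · simp [permVertex, hl]
  · intro i h1 h2
    simp only [permVertex, List.getElem_ofFn]
    exact hp ⟨i, by omega⟩

theorem permVertex_rot {m : ℕ} (p : Equiv.Perm (Fin (m + 3))) :
    JacksonEdge (permVertex p) (permVertex (p * finRotate (m + 3))) := by
  rw [edge_out (by omega)]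
  refine ⟨p ⟨m + 1, by omega⟩, ?_, ?_⟩
  · simp only [permVertex, List.mem_ofFn, not_exists]
    intro i h
    have := congrArg Fin.val (p.injective h)
    simp at this
    omega
  · apply List.ext_getElem
    · simp [permVertex]
    · intro i h1 h2
      have hi : i < m + 1 := by simpa [permVertex] using h1
      have hr : finRotate (m + 3) ⟨i, by omega⟩ = ⟨i + 1, by omega⟩ :=
        finRotate_of_lt (by omega)
      simp only [permVertex, List.getElem_ofFn, Equiv.Perm.mul_apply, List.getElem_append,
        List.getElem_tail, List.length_tail, List.length_ofFn]
      have : (Fin.castLE (by omega) (⟨i, hi⟩ : Fin (m + 1)) : Fin (m + 3)) = ⟨i, by omega⟩ := rfl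
      rw [this, hr]
      split_ifs with h
      · rfl
      · have : i = m := by omega
        subst this
        simp

theorem permVertex_swap {m : ℕ} (p : Equiv.Perm (Fin (m + 3))) :
    permVertex (p * Equiv.swap ⟨m + 1, by omega⟩ ⟨m + 2, by omega⟩) = permVertex p := by
  apply Subtype.ext
  simp only [permVertex]
  congr 1
  funext i
  rw [Equiv.Perm.mul_apply, Equiv.swap_apply_of_ne_of_ne]
  · intro h
    have := congrArg Fin.val h
    simp at this
    omega
  · intro h
    have := congrArg Fin.val h
    simp at this
    omega

theorem jackson_conn {m : ℕ} (u v : JacksonVertex (m + 3)) :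
    Relation.ReflTransGen JacksonEdge u v := by
  let M : Submonoid (Equiv.Perm (Fin (m + 3))) :=
    { carrier := {g | ∀ p, Relation.ReflTransGen JacksonEdge (permVertex p) (permVertex (p * g))}
      one_mem' := fun p => by simpa using Relation.ReflTransGen.refl
      mul_mem' := fun {a b} ha hb p => by
        rw [← mul_assoc]
        exact (ha p).trans (hb _) }
  have hr : finRotate (m + 3) ⟨m + 1, by omega⟩ = ⟨m + 2, by omega⟩ :=
    finRotate_of_lt (by omega)
  have hcl := Equiv.Perm.closure_cycle_adjacent_swap (isCycle_finRotate (n := m + 1))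
    (by simpa using support_finRotate (n := m + 1)) ⟨m + 1, by omega⟩
  have hsub : ({finRotate (m + 3), Equiv.swap ⟨m + 1, by omega⟩ ⟨m + 2, by omega⟩} :
      Set (Equiv.Perm (Fin (m + 3)))) ⊆ M := by
    rintro g (rfl | rfl)
    · exact fun p => Relation.ReflTransGen.single (permVertex_rot p)
    · intro p
      rw [permVertex_swap]
  have hM : ∀ g, g ∈ M := by
    intro g
    have hg : g ∈ Subgroup.closure ({finRotate (m + 3),
      Equiv.swap ⟨m + 1, by omega⟩ ⟨m + 2, by omega⟩} : Set (Equiv.Perm (Fin (m + 3)))) := by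
      rw [hr] at hcl
      rw [hcl]; trivial
    rw [← Subgroup.mem_toSubmonoid, Subgroup.closure_toSubmonoid_of_finite] at hg
    exact (Submonoid.closure_le.2 hsub) hg
  obtain ⟨p, rfl⟩ := permVertex_surj u
  obtain ⟨q, rfl⟩ := permVertex_surj v
  have := hM (p⁻¹ * q) p
  rwa [mul_inv_cancel_left] at this

/-- For every `n > 2`, the Jackson graph `J(n)` is (strongly) connected, every vertex has
indegree `2` and outdegree `2`, and consequently `J(n)` admits an Eulerian cycle. -/
theorem stmt_2 (n : ℕ) (hn : 2 < n) :
    (∀ u v : JacksonVertex n, Relation.ReflTransGen JacksonEdge u v) ∧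
    (∀ v : JacksonVertex n, {u | JacksonEdge u v}.ncard = 2) ∧
    (∀ u : JacksonVertex n, {v | JacksonEdge u v}.ncard = 2) ∧
    (∃ c : List (JacksonVertex n), IsEulerianCycle JacksonEdge c) := by
  obtain ⟨m, rfl⟩ : ∃ m, n = m + 3 := ⟨n - 3, by omega⟩
  refine ⟨jackson_conn, indeg hn, outdeg hn, ?_⟩
  have hfin : Finite (JacksonVertex (m + 3)) :=
    Finite.of_surjective permVertex permVertex_surj
  exact euler_aux _ jackson_conn (fun v => (indeg hn v).trans (outdeg hn v).symm)
    ⟨_, _, permVertex_rot 1⟩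
end

section
/- The reversal of a universal Lyndon word of degree n is a universal Lyndon word of degree n. -/
/-- `v` is a conjugate (cyclic rotation) of `w` : `w = w₁w₂` and `v = w₂w₁`. -/
def IsConjugate {α : Type*} (w v : List α) : Prop :=
  ∃ w₁ w₂ : List α, w = w₁ ++ w₂ ∧ v = w₂ ++ w₁

/-- `u` is a cyclic factor of `w` : `u` is a factor of `ww` and `|u| ≤ |w|`. -/
def IsCyclicFactor {α : Type*} (w u : List α) : Prop :=
  u <:+: (w ++ w) ∧ u.length ≤ w.length

/-- The number of occurrences of `u` as a cyclic factor of `w`, i.e. the number of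
occurrences of `u` in `ww` beginning at one of the first `|w|` positions. -/
def cyclicOcc {α : Type*} [DecidableEq α] (w u : List α) : ℕ :=
  ((Finset.range w.length).filter fun i => u <+: (w ++ w).drop i).card

/-- `w` is lexicographically strictly smaller, with respect to the lexicographic order
induced by the order `r` on the letters, than all of its proper conjugates. -/
def IsLyndonWith {n : ℕ} (r : Fin n → Fin n → Prop) (w : List (Fin n)) : Prop :=
  ∀ w₁ w₂ : List (Fin n), w = w₁ ++ w₂ → w₁ ≠ [] → w₂ ≠ [] →
    List.Lex r w (w₂ ++ w₁)

/-- `w` is a Lyndon word: it is Lyndon with respect to some total order on the alphabet. -/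
def IsLyndon {n : ℕ} (w : List (Fin n)) : Prop :=
  ∃ r : Fin n → Fin n → Prop, IsStrictTotalOrder (Fin n) r ∧ IsLyndonWith r w

/-- A universal Lyndon word of degree `n` : a word over `Σ_n` of length `n!`
all of whose conjugates are Lyndon words. -/
def IsULW (n : ℕ) (w : List (Fin n)) : Prop :=
  w.length = Nat.factorial n ∧ ∀ v, IsConjugate w v → IsLyndon v


namespace ULW

/-- Agreement of the factors of length `k` starting at `i` and `j`. -/
def Ag {n : ℕ} (s : ℤ → Fin n) (i j : ℤ) (k : ℕ) : Prop :=
  ∀ l : ℕ, l < k → s (i + l) = s (j + l)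

/-- The conjugate at `i` is minimal for the order with rank function `σ`. -/
def Good {n : ℕ} (s : ℤ → Fin n) (i : ℤ) (σ : Equiv.Perm (Fin n)) : Prop :=
  ∀ (j : ℤ) (k : ℕ), Ag s i j k → s (i + k) ≠ s (j + k) → σ (s (i + k)) < σ (s (j + k))

/-- `x` does not occur in the factor of length `k` at `i`. -/
def New {n : ℕ} (s : ℤ → Fin n) (i : ℤ) (k : ℕ) (x : Fin n) : Prop :=
  ∀ l : ℕ, l < k → s (i + l) ≠ x

/-- `σ` is compatible with the order of first occurrences in the factor of length `k` at `i`. -/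
def Compat {n : ℕ} (s : ℤ → Fin n) (i : ℤ) (k : ℕ) (σ : Equiv.Perm (Fin n)) : Prop :=
  ∀ l : ℕ, l < k → New s i l (s (i + l)) → ∀ y, New s i l y → y ≠ s (i + l) →
    σ (s (i + l)) < σ y

def Q1 {n : ℕ} (s : ℤ → Fin n) (k : ℕ) : Prop :=
  ∀ i, New s i k (s (i + k)) → ∀ b, New s i k b → ∃ j, Ag s i j k ∧ s (j + k) = b

def Q2 {n : ℕ} (s : ℤ → Fin n) (k : ℕ) : Prop :=
  ∀ i, ¬ New s i k (s (i + k)) → ∀ j, Ag s i j k → s (j + k) = s (i + k)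

theorem Ag.symm {n : ℕ} {s : ℤ → Fin n} {i j : ℤ} {k : ℕ} (h : Ag s i j k) : Ag s j i k :=
  fun l hl => (h l hl).symm

theorem Ag.trans {n : ℕ} {s : ℤ → Fin n} {i j m : ℤ} {k : ℕ} (h : Ag s i j k)
    (h' : Ag s j m k) : Ag s i m k :=
  fun l hl => (h l hl).trans (h' l hl)

theorem Ag.mono {n : ℕ} {s : ℤ → Fin n} {i j : ℤ} {k l : ℕ} (h : Ag s i j k) (hl : l ≤ k) :
    Ag s i j l :=
  fun m hm => h m (by omega)

theorem Ag.succ {n : ℕ} {s : ℤ → Fin n} {i j : ℤ} {k : ℕ} (h : Ag s i j k)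
    (h' : s (i + k) = s (j + k)) : Ag s i j (k + 1) := by
  intro l hl
  rcases Nat.lt_succ_iff_lt_or_eq.1 hl with h1 | rfl
  · exact h l h1
  · exact h'

theorem Ag.tail {n : ℕ} {s : ℤ → Fin n} {i j : ℤ} {k : ℕ} (h : Ag s i j (k + 1)) :
    Ag s (i + 1) (j + 1) k := by
  intro l hl
  have := h (l + 1) (by omega)
  push_cast at this
  rw [show i + 1 + (l : ℤ) = i + (l + 1) by ring, show j + 1 + (l : ℤ) = j + (l + 1) by ring]
  exact this

theorem New.congr {n : ℕ} {s : ℤ → Fin n} {i j : ℤ} {k : ℕ} {x : Fin n} (h : New s i k x)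
    (h' : Ag s i j k) : New s j k x :=
  fun l hl => by rw [← h' l hl]; exact h l hl

/-- rank function of a strict total order -/
theorem exists_rank {n : ℕ} (r : Fin n → Fin n → Prop) [IsStrictTotalOrder (Fin n) r] :
    ∃ σ : Equiv.Perm (Fin n), ∀ x y, r x y ↔ σ x < σ y := by
  classical
  let c : Fin n → Finset (Fin n) := fun x => Finset.univ.filter (fun y => r y x)
  have hc : ∀ x, (c x).card < n := by
    intro x
    have : (c x).card < (Finset.univ : Finset (Fin n)).card := by
      apply Finset.card_lt_card
      rw [Finset.ssubset_univ_iff]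
      intro h
      have : x ∈ c x := by rw [h]; exact Finset.mem_univ _
      exact irrefl_of r x (Finset.mem_filter.1 this).2
    simpa using this
  let f : Fin n → Fin n := fun x => ⟨(c x).card, hc x⟩
  have hmono : ∀ x y, r x y → f x < f y := by
    intro x y hxy
    show (c x).card < (c y).card
    apply Finset.card_lt_card
    refine ⟨?_, ?_⟩
    · intro z hz
      have := (Finset.mem_filter.1 hz).2
      exact Finset.mem_filter.2 ⟨Finset.mem_univ _, trans_of r this hxy⟩
    · intro h
      have : x ∈ c x := h (Finset.mem_filter.2 ⟨Finset.mem_univ _, hxy⟩)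
      exact irrefl_of r x (Finset.mem_filter.1 this).2
  have hinj : Function.Injective f := by
    intro x y hxy
    rcases trichotomous_of r x y with h | h | h
    · exact absurd (hmono _ _ h) (by simp [hxy])
    · exact h
    · exact absurd (hmono _ _ h) (by simp [hxy])
  refine ⟨Equiv.ofBijective f (Finite.injective_iff_bijective.1 hinj), ?_⟩
  intro x y
  refine ⟨fun h => hmono _ _ h, fun h => ?_⟩
  change f x < f y at h
  rcases trichotomous_of r x y with h' | h' | h'
  · exact h'
  · subst h'; exact absurd h (lt_irrefl _)
  · exact absurd h (not_lt_of_gt (hmono _ _ h'))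

theorem exists_rank_key {n : ℕ} (key : Fin n → ℕ) (hk : Function.Injective key) :
    ∃ σ : Equiv.Perm (Fin n), ∀ x y, σ x < σ y ↔ key x < key y := by
  have : IsStrictTotalOrder (Fin n) (fun x y => key x < key y) :=
    { trichotomous := fun x y h1 h2 => hk (by omega)
      irrefl := fun x => lt_irrefl _
      trans := fun x y z h1 h2 => lt_trans h1 h2 }
  obtain ⟨σ, h⟩ := exists_rank (fun x y : Fin n => key x < key y)
  exact ⟨σ, fun x y => (h x y).symm⟩

/-- The abstract setting. -/
structure Setup (n : ℕ) (s : ℤ → Fin n) : Prop where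
  per : ∀ i, s (i + (n.factorial : ℤ)) = s i
  prim : ∀ i j, (∀ k, Ag s i j k) → (n.factorial : ℤ) ∣ i - j
  good : ∀ i, ∃ σ, Good s i σ

section
variable {n : ℕ} {s : ℤ → Fin n}

theorem per_mul (per : ∀ i, s (i + (n.factorial : ℤ)) = s i) (i m : ℤ) :
    s (i + m * (n.factorial : ℤ)) = s i := by
  have h : Function.Periodic s (n.factorial : ℤ) := per
  exact h.int_mul m i

theorem per_dvd (per : ∀ i, s (i + (n.factorial : ℤ)) = s i) {i j : ℤ}
    (h : (n.factorial : ℤ) ∣ i - j) : s i = s j := by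
  obtain ⟨m, hm⟩ := h
  have : i = j + m * (n.factorial : ℤ) := by linarith
  rw [this, per_mul per]

theorem Setup.good_pos (S : Setup n s) {i j : ℤ} {σ} (hi : Good s i σ) (hj : Good s j σ) :
    (n.factorial : ℤ) ∣ i - j := by
  apply S.prim
  intro k
  induction k with
  | zero => intro l hl; omega
  | succ k ih =>
    apply ih.succ
    by_contra hne
    exact lt_asymm (hi j k ih hne) (hj i k ih.symm (Ne.symm hne))

theorem Setup.good_congr (S : Setup n s) {i j : ℤ} {σ} (h : (n.factorial : ℤ) ∣ i - j)
    (hi : Good s i σ) : Good s j σ := by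
  have e : ∀ l : ℕ, s (j + l) = s (i + l) := fun l =>
    (per_dvd S.per (by simpa using h)).symm
  intro m k hm
  rw [e]
  exact hi m k (fun l hl => by rw [← e, hm l hl])

theorem Setup.bij (S : Setup n s) :
    ∃ F : Fin n.factorial → Equiv.Perm (Fin n), Function.Bijective F ∧
      ∀ i : Fin n.factorial, Good s ((i : ℕ) : ℤ) (F i) := by
  choose G hG using S.good
  refine ⟨fun i => G (i : ℕ), ?_, fun i => hG _⟩
  rw [Fintype.bijective_iff_injective_and_card]
  constructor
  · intro i j hij
    have h1 := hG (i : ℕ)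
    have h2 := hG (j : ℕ)
    simp only at hij
    rw [hij] at h1
    have := S.good_pos h1 h2
    have h3 := i.2
    have h4 := j.2
    apply Fin.ext
    have := Int.eq_zero_of_abs_lt_dvd this (by rw [abs_lt]; constructor <;> omega)
    omega
  · simp [Fintype.card_perm]

theorem Setup.exists_pos (S : Setup n s) (σ : Equiv.Perm (Fin n)) : ∃ i, Good s i σ := by
  obtain ⟨F, hF, hg⟩ := S.bij
  obtain ⟨i, rfl⟩ := hF.2 σ
  exact ⟨_, hg i⟩

theorem Setup.unique (S : Setup n s) {i : ℤ} {σ τ} (hσ : Good s i σ) (hτ : Good s i τ) :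
    σ = τ := by
  obtain ⟨F, hF, hg⟩ := S.bij
  obtain ⟨a, rfl⟩ := hF.2 σ
  obtain ⟨b, rfl⟩ := hF.2 τ
  have h1 := S.good_pos (hg a) hσ
  have h2 := S.good_pos (hg b) hτ
  have h5 : (n.factorial : ℤ) ∣ (a : ℕ) - (b : ℕ) := by
    have := dvd_sub h1 h2
    simpa using this
  have h3 := a.2
  have h4 := b.2
  have := Int.eq_zero_of_abs_lt_dvd h5 (by rw [abs_lt]; constructor <;> omega)
  congr 1
  apply Fin.ext
  omega

theorem Setup.adjacent (S : Setup n s) {i : ℤ} {σ} (hσ : Good s i σ) {a b : Fin n}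
    (hab : σ b < σ a) (hadj : ∀ c, σ b < σ c → σ a ≤ σ c) :
    ∃ (j : ℤ) (k : ℕ), Ag s i j k ∧ s (i + k) = b ∧ s (j + k) = a := by
  by_contra hcon
  push Not at hcon
  have hτ : Good s i (σ * Equiv.swap a b) := by
    intro j k hjk hne
    have h1 := hσ j k hjk hne
    have h2 := hcon j k hjk
    generalize s (i + k) = x at *
    generalize s (j + k) = y at *
    simp only [Equiv.Perm.mul_apply]
    have hba : b ≠ a := by rintro rfl; exact lt_irrefl _ hab
    have inj : ∀ u v, σ u = σ v → u = v := fun u v h => σ.injective h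
    rcases eq_or_ne x a with rfl | hxa
    · rw [Equiv.swap_apply_left]
      rcases eq_or_ne y b with rfl | hyb
      · exact absurd h1 (not_lt_of_gt hab)
      · rw [Equiv.swap_apply_of_ne_of_ne (Ne.symm hne) hyb]
        exact hab.trans h1
    · rcases eq_or_ne x b with rfl | hxb
      · rw [Equiv.swap_apply_right]
        have hya := h2 rfl
        rw [Equiv.swap_apply_of_ne_of_ne hya (Ne.symm hne)]
        exact lt_of_le_of_ne (hadj y h1) (fun h => hya (inj _ _ h).symm)
      · rw [Equiv.swap_apply_of_ne_of_ne hxa hxb]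
        rcases eq_or_ne y a with rfl | hya
        · rw [Equiv.swap_apply_left]
          by_contra h
          have : σ b < σ x := lt_of_le_of_ne (not_lt.1 h) (fun h => hxb (inj _ _ h).symm)
          exact absurd h1 (not_lt_of_ge (hadj x this))
        · rcases eq_or_ne y b with rfl | hyb
          · rw [Equiv.swap_apply_right]
            exact h1.trans hab
          · rw [Equiv.swap_apply_of_ne_of_ne hya hyb]
            exact h1
  have := S.unique hσ hτ
  have h3 : σ a = (σ * Equiv.swap a b) a := by rw [← this]
  simp only [Equiv.Perm.mul_apply, Equiv.swap_apply_left] at h3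
  rw [h3] at hab
  exact lt_irrefl _ hab

theorem exists_first {i : ℤ} {k : ℕ} {x : Fin n} (h : ¬ New s i k x) :
    ∃ l, l < k ∧ s (i + (l : ℕ)) = x ∧ New s i l x := by
  classical
  unfold New at h
  push Not at h
  have h' : ∃ l : ℕ, l < k ∧ s (i + l) = x := h
  refine ⟨Nat.find h', (Nat.find_spec h').1, (Nat.find_spec h').2, ?_⟩
  intro l hl he
  exact Nat.find_min h' hl ⟨lt_trans hl (Nat.find_spec h').1, he⟩

theorem Setup.q2 (S : Setup n s) (k : ℕ) (ih : ∀ l < k, Q1 s l) : Q2 s k := by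
  intro i hi j hij
  by_contra hne
  obtain ⟨l, hlk, hl, hnew⟩ := exists_first hi
  by_cases hb : New s i l (s (j + k))
  · obtain ⟨j', hj', hj'l⟩ := ih l hlk i (by rw [hl]; exact hnew) _ hb
    obtain ⟨σ, hσ⟩ := S.good j
    have h1 := hσ i k hij.symm hne
    have e : s (j + l) = s (i + k) := by rw [← hij l hlk, hl]
    have h2 := hσ j' l ((hij.mono hlk.le).symm.trans hj') (by rw [hj'l, e]; exact Ne.symm hne)
    rw [hj'l, e] at h2
    exact lt_asymm h1 h2
  · obtain ⟨m, hml, hm, hmnew⟩ := exists_first hb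
    obtain ⟨j', hj', hj'm⟩ := ih m (hml.trans hlk) i (by rw [hm]; exact hmnew) (s (i + k))
      (fun t ht => hnew t (ht.trans hml))
    obtain ⟨σ, hσ⟩ := S.good i
    have h1 := hσ j k hij (Ne.symm hne)
    have h2 := hσ j' m hj' (by rw [hj'm, hm]; exact hne)
    rw [hj'm, hm] at h2
    exact lt_asymm h1 h2

theorem greedy {k : ℕ} (q2 : ∀ l < k, Q2 s l) {i j : ℤ} {σ} (hj : Good s j σ)
    (hc : Compat s i k σ) : Ag s i j k := by
  have : ∀ l ≤ k, Ag s i j l := by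
    intro l
    induction l with
    | zero => intro _ m hm; omega
    | succ l ih =>
      intro hl
      have h0 := ih (by omega)
      apply h0.succ
      by_contra hne
      have h1 := hj i l h0.symm (Ne.symm hne)
      have n1 : New s i l (s (i + l)) := by
        by_contra hh
        exact hne (q2 l (by omega) i hh j h0).symm
      have n2 : New s j l (s (j + l)) := by
        by_contra hh
        exact hne (q2 l (by omega) j hh i h0.symm)
      have h2 := hc l (by omega) n1 _ (n2.congr h0.symm) (Ne.symm hne)
      exact lt_asymm h1 h2
  exact this k le_rfl

theorem exists_order {i : ℤ} {k : ℕ} {a b : Fin n} (ha : New s i k a) (hb : New s i k b)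
    (hab : a ≠ b) : ∃ σ : Equiv.Perm (Fin n), Compat s i k σ ∧ σ b < σ a ∧
      (∀ c, σ b < σ c → σ a ≤ σ c) ∧ (∀ c, σ c < σ a → c = b ∨ ¬ New s i k c) := by
  classical
  have hf : ∀ x, ∃ l : ℕ, ¬ New s i k x → l < k ∧ s (i + (l : ℕ)) = x ∧ New s i l x := by
    intro x
    by_cases hx : New s i k x
    · exact ⟨0, fun h => absurd hx h⟩
    · obtain ⟨l, hl⟩ := exists_first hx
      exact ⟨l, fun _ => hl⟩
  choose f hf using hf
  let key : Fin n → ℕ := fun x => if New s i k x then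
    (if x = b then k else if x = a then k + 1 else k + 2 + x) else f x
  have keyn : ∀ x, ¬ New s i k x → key x = f x := fun x hx => by simp [key, hx]
  have keyb : key b = k := by simp [key, hb]
  have keya : key a = k + 1 := by simp [key, ha, hab]
  have keyo : ∀ x, New s i k x → x ≠ a → x ≠ b → key x = k + 2 + x := fun x h1 h2 h3 => by
    simp [key, h1, h2, h3]
  have hinj : Function.Injective key := by
    intro x y hxy
    by_cases hx : New s i k x
    · by_cases hy : New s i k y
      · simp only [key, hx, hy, if_true] at hxy
        split_ifs at hxy <;> first | (subst_vars; rfl) | omega | (apply Fin.ext; omega)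
      · have h1 := (hf y hy).1
        have : k ≤ key x := by
          simp only [key, hx, if_true]; split_ifs <;> omega
        rw [hxy, keyn y hy] at this
        omega
    · by_cases hy : New s i k y
      · have h1 := (hf x hx).1
        have : k ≤ key y := by
          simp only [key, hy, if_true]; split_ifs <;> omega
        rw [← hxy, keyn x hx] at this
        omega
      · rw [keyn x hx, keyn y hy] at hxy
        rw [← (hf x hx).2.1, ← (hf y hy).2.1, hxy]
  obtain ⟨σ, hσ⟩ := exists_rank_key key hinj
  refine ⟨σ, ?_, ?_, ?_, ?_⟩
  · intro l hl hnew y hy hne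
    rw [hσ]
    have hx : ¬ New s i k (s (i + l)) := fun h => h l hl rfl
    rw [keyn _ hx]
    obtain ⟨h1, h2, h3⟩ := hf _ hx
    have hle : f (s (i + l)) ≤ l := by
      by_contra hh
      exact h3 l (by omega) rfl
    by_cases hyn : New s i k y
    · have : k ≤ key y := by
        simp only [key, hyn, if_true]; split_ifs <;> omega
      omega
    · rw [keyn _ hyn]
      obtain ⟨h4, h5, h6⟩ := hf _ hyn
      have : ¬ f y < l := fun h => hy _ h h5
      have : f y ≠ l := fun h => hne (by rw [← h5, h])
      omega
  · rw [hσ, keyb, keya]; omega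
  · intro c
    rw [hσ, ← not_lt, hσ, keyb, keya]
    omega
  · intro c
    rw [hσ, keya]
    intro h
    by_contra hcon
    push Not at hcon
    rcases eq_or_ne c a with rfl | hca
    · omega
    · have := keyo c hcon.2 hca hcon.1
      omega

theorem Setup.q1 (S : Setup n s) (k : ℕ) (ih : ∀ l < k, Q1 s l) : Q1 s k := by
  intro i ha b hb
  by_contra hcon
  push Not at hcon
  have hab : s (i + k) ≠ b := hcon i (fun _ _ => rfl)
  obtain ⟨σ, hc, hlt, hadj, hlow⟩ := exists_order ha hb hab
  obtain ⟨j₀, hj₀⟩ := S.exists_pos σ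
  have q2 : ∀ l ≤ k, Q2 s l := fun l hl => S.q2 l (fun m hm => ih m (by omega))
  have h0 : Ag s i j₀ k := greedy (fun l hl => q2 l hl.le) hj₀ hc
  have h0k : s (i + k) = s (j₀ + k) := by
    by_contra hne
    rcases hlow _ (hj₀ i k h0.symm (Ne.symm hne)) with h | h
    · exact hcon j₀ h0 h
    · exact hne (q2 k le_rfl j₀ (fun h' => h (h'.congr h0.symm)) i h0.symm)
  obtain ⟨j₁, m, h1, h1b, h1a⟩ := S.adjacent hj₀ hlt hadj
  rcases lt_trichotomy m k with hm | rfl | hm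
  · exact hb m hm (by rw [h0 m hm, h1b])
  · exact hab (by rw [h0k, h1b])
  · rcases k with _ | k
    · exact hcon (j₀ + m) (fun l hl => by omega) (by simpa using h1b)
    · obtain ⟨m, rfl⟩ : ∃ m', m = m' + 1 := ⟨m - 1, by omega⟩
      have e : ∀ (x : ℤ) (t : ℕ), x + ((t + 1 : ℕ) : ℤ) = x + 1 + t := fun x t => by
        push_cast; ring
      rw [e] at ha hab h1b
      rw [e, e] at h0k h1a
      have tl : ∀ x, New s i (k + 1) x → New s (i + 1) k x := by
        intro x hx l hl
        have := hx (l + 1) (by omega)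
        rwa [e] at this
      obtain ⟨j₂, h2, h2b⟩ := ih k (by omega) (i + 1) (tl _ ha) b (tl _ hb)
      obtain ⟨τ, hτ⟩ := S.good (j₀ + 1)
      have t1 := hτ (j₁ + 1) m h1.tail (by rw [h1b, h1a]; exact Ne.symm hab)
      have t2 := hτ j₂ k (h0.tail.symm.trans h2) (by rw [h2b, ← h0k]; exact hab)
      rw [h1b, h1a] at t1
      rw [h2b, ← h0k] at t2
      exact lt_asymm t1 t2

theorem Setup.q1' (S : Setup n s) (k : ℕ) : Q1 s k :=
  Nat.strong_induction_on k fun k ih => S.q1 k ih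

theorem Setup.q2' (S : Setup n s) (k : ℕ) : Q2 s k := S.q2 k fun l _ => S.q1' l

theorem Setup.compat_of_ag (S : Setup n s) {i j : ℤ} {k : ℕ} {σ} (hj : Good s j σ)
    (h : Ag s i j k) : Compat s i k σ := by
  intro l hl hnew y hy hne
  obtain ⟨j', hj', hy'⟩ := S.q1' l i hnew y hy
  have e := h l hl
  have := hj j' l ((h.mono hl.le).symm.trans hj') (by rw [hy', ← e]; exact Ne.symm hne)
  rwa [hy', ← e] at this

theorem compat_lt {i : ℤ} {k : ℕ} {σ} (hc : Compat s i k σ) {l : ℕ} (hl : l < k)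
    (hnew : New s i l (s (i + l))) (y : Fin n) :
    σ y < σ (s (i + l)) ↔ ¬ New s i l y := by
  constructor
  · intro h hn
    rcases eq_or_ne y (s (i + l)) with rfl | hne
    · exact lt_irrefl _ h
    · exact lt_asymm h (hc l hl hnew y hn hne)
  · intro h
    obtain ⟨m, hm, rfl, hmn⟩ := exists_first h
    exact hc m (by omega) hmn _ (fun t ht => hnew t (by omega)) (Ne.symm (hnew m hm))

theorem compat_eq {i : ℤ} {k : ℕ} {σ τ} (hc : Compat s i k σ) (hc' : Compat s i k τ)
    {x : Fin n} (hx : ¬ New s i k x) : σ x = τ x := by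
  classical
  obtain ⟨l, hl, rfl, hnew⟩ := exists_first hx
  have key : ∀ ρ : Equiv.Perm (Fin n), ∀ z, (Finset.univ.filter (fun y => ρ y < ρ z)).card
      = (ρ z : ℕ) := by
    intro ρ z
    have : (Finset.univ.filter (fun y => ρ y < ρ z)).map ρ.toEmbedding = Finset.Iio (ρ z) := by
      ext y
      simp only [Finset.mem_map, Finset.mem_filter, Finset.mem_univ, true_and, Finset.mem_Iio]
      constructor
      · rintro ⟨u, hu, rfl⟩; exact hu
      · intro hy; exact ⟨ρ.symm y, by simpa using hy, by simp⟩
    rw [← Finset.card_map ρ.toEmbedding, this, Fin.card_Iio]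
  apply Fin.ext
  rw [← key σ, ← key τ]
  congr 1
  ext y
  simp only [Finset.mem_filter, Finset.mem_univ, true_and]
  rw [compat_lt hc hl hnew, compat_lt hc' hl hnew]

theorem compat_of_eq {i : ℤ} {k : ℕ} {σ τ : Equiv.Perm (Fin n)} (hc : Compat s i k σ)
    (he : ∀ x, ¬ New s i k x → τ x = σ x) : Compat s i k τ := by
  intro l hl hnew y hy hne
  rw [he (s (i + l)) (fun h => h l hl rfl)]
  by_cases hyn : New s i k y
  · have hy' : New s i k (σ.symm (τ y)) := by
      by_contra hh
      have h1 := he _ hh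
      rw [Equiv.apply_symm_apply] at h1
      exact hh (by rw [τ.injective h1]; exact hyn)
    have := hc l hl hnew (σ.symm (τ y)) (fun m hm => hy' m (by omega))
      (fun h => hy' l hl h.symm)
    simpa using this
  · rw [he y hyn]
    exact hc l hl hnew y hy hne

theorem Setup.left (S : Setup n s) {i j : ℤ} {k : ℕ} (h : Ag s i j k)
    (hi : ¬ New s i k (s (i - 1))) : s (j - 1) = s (i - 1) := by
  classical
  choose Z hZ using S.exists_pos
  choose O hO using S.good
  let A : Finset (Equiv.Perm (Fin n)) := Finset.univ.filter (fun σ => Compat s i k σ)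
  let B : Finset (Equiv.Perm (Fin n)) :=
    Finset.univ.filter (fun σ => Compat s (i - 1) (k + 1) σ)
  have memA : ∀ σ, σ ∈ A ↔ Compat s i k σ := fun σ => by simp [A]
  have memB : ∀ σ, σ ∈ B ↔ Compat s (i - 1) (k + 1) σ := fun σ => by simp [B]
  have q2 : ∀ l, Q2 s l := S.q2'
  have alph : ∀ x, ¬ New s (i - 1) (k + 1) x → ¬ New s i k x := by
    intro x hx hn
    obtain ⟨l, hl, hlx, -⟩ := exists_first hx
    rcases l with _ | l
    · apply hi
      simp only [Nat.cast_zero, add_zero] at hlx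
      rw [hlx]; exact hn
    · apply hn l (by omega)
      rw [← hlx]; congr 1; push_cast; ring
  have σ0 : Compat s i k (O i) := S.compat_of_ag (hO i) (fun _ _ => rfl)
  have τ0 : Compat s (i - 1) (k + 1) (O (i - 1)) :=
    S.compat_of_ag (hO (i - 1)) (fun _ _ => rfl)
  have hcard : A.card ≤ B.card := by
    apply Finset.card_le_card_of_injOn (fun σ => O (i - 1) * (O i)⁻¹ * σ)
    · intro σ hσ
      have hσ' := (memA σ).1 hσ
      refine (memB _).2 (compat_of_eq τ0 ?_)
      intro x hx
      have := compat_eq hσ' σ0 (alph x hx)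
      simp [this]
    · intro σ _ τ _ hst
      simpa using hst
  let T : Equiv.Perm (Fin n) → Equiv.Perm (Fin n) := fun σ => O (Z σ + 1)
  have hT : Set.MapsTo T B A := by
    intro σ hσ
    have hσ' := (memB σ).1 hσ
    have ag : Ag s (i - 1) (Z σ) (k + 1) := greedy (fun l _ => q2 l) (hZ σ) hσ'
    have := ag.tail
    rw [sub_add_cancel] at this
    exact (memA _).2 (S.compat_of_ag (hO _) this)
  have hTi : Set.InjOn T B := by
    intro σ _ τ _ hst
    have h1 := hO (Z σ + 1)
    have h2 := hO (Z τ + 1)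
    change O (Z σ + 1) = O (Z τ + 1) at hst
    rw [hst] at h1
    have := S.good_pos h1 h2
    rw [add_sub_add_right_eq_sub] at this
    exact S.unique (S.good_congr this (hZ σ)) (hZ τ)
  have hsurj := Finset.surjOn_of_injOn_of_card_le T hT hTi hcard
  have hj : O j ∈ A := (memA _).2 (S.compat_of_ag (hO j) h)
  obtain ⟨σ, hσ, hσj⟩ := hsurj hj
  have hσ' := (memB σ).1 hσ
  have ag : Ag s (i - 1) (Z σ) (k + 1) := greedy (fun l _ => q2 l) (hZ σ) hσ'
  have h1 := hO (Z σ + 1)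
  have h2 := hO j
  change O (Z σ + 1) = O j at hσj
  rw [hσj] at h1
  have hd := S.good_pos h1 h2
  have e0 := ag 0 (by omega)
  simp only [Nat.cast_zero, add_zero] at e0
  rw [e0]
  symm
  apply per_dvd S.per
  rw [show Z σ - (j - 1) = Z σ + 1 - j by ring]
  exact hd

theorem Setup.reverse (S : Setup n s) : Setup n (fun i => s (-1 - i)) := by
  classical
  have fpos : 0 < (n.factorial : ℤ) := by exact_mod_cast n.factorial_pos
  refine ⟨?_, ?_, ?_⟩
  · intro i
    apply per_dvd S.per
    exact ⟨-1, by ring⟩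
  · intro i j h
    have : (n.factorial : ℤ) ∣ (-1 - i) - (-1 - j) := by
      apply S.prim
      intro k l _
      have hl := h (l * n.factorial - l + 1) (l * n.factorial - l) (by omega)
      have hle : l ≤ l * n.factorial := Nat.le_mul_of_pos_right _ n.factorial_pos
      simp only at hl
      have e : ∀ x : ℤ, s (-1 - (x + ((l * n.factorial - l : ℕ) : ℤ))) = s (-1 - x + l) := by
        intro x
        apply per_dvd S.per
        rw [Nat.cast_sub hle]
        exact ⟨-l, by push_cast; ring⟩
      rw [e, e] at hl
      exact hl
    have h2 := (dvd_neg).2 this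
    rw [show -((-1 - i) - (-1 - j)) = i - j by ring] at h2
    exact h2
  · intro i
    have hocc : ∀ x : Fin n, ∃ l : ℕ, s (-1 - (i + l)) = x := by
      intro x
      obtain ⟨j, -, hj⟩ := S.q1' 0 0 (fun l hl => by omega) x (fun l hl => by omega)
      simp only [Nat.cast_zero, add_zero] at hj
      refine ⟨((-1 - i - j) % (n.factorial : ℤ)).toNat, ?_⟩
      rw [Int.toNat_of_nonneg (Int.emod_nonneg _ fpos.ne'), ← hj]
      apply per_dvd S.per
      refine ⟨(-1 - i - j) / (n.factorial : ℤ), ?_⟩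
      have := Int.emod_add_mul_ediv (-1 - i - j) (n.factorial : ℤ)
      linarith
    obtain ⟨σ, hσ⟩ := exists_rank_key (fun x => Nat.find (hocc x)) (by
      intro x y hxy
      have h1 := Nat.find_spec (hocc x)
      have h2 := Nat.find_spec (hocc y)
      simp only at hxy
      rw [hxy] at h1
      exact h1.symm.trans h2)
    refine ⟨σ, ?_⟩
    intro j k hag hne
    rw [hσ]
    simp only at hne ⊢
    have ag : Ag s (-i - k) (-j - k) k := by
      intro l hl
      have := hag (k - 1 - l) (by omega)
      simp only at this
      have e : ((k - 1 - l : ℕ) : ℤ) = k - 1 - l := by omega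
      rw [e] at this
      rw [show -i - (k : ℤ) + l = -1 - (i + (k - 1 - l)) by ring,
        show -j - (k : ℤ) + l = -1 - (j + (k - 1 - l)) by ring]
      exact this
    have ei : (-i - (k : ℤ)) - 1 = -1 - (i + k) := by ring
    have ej : (-j - (k : ℤ)) - 1 = -1 - (j + k) := by ring
    have hnj : New s (-j - k) k (s (-1 - (j + k))) := by
      rw [← ej]
      by_contra hh
      have := S.left ag.symm hh
      rw [ei, ej] at this
      exact hne this
    have hnj' := hnj.congr ag.symm
    have h1 : Nat.find (hocc (s (-1 - (i + k)))) ≤ k := Nat.find_min' _ rfl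
    refine lt_of_le_of_lt h1 ?_
    rw [Nat.lt_find_iff]
    intro m hm he
    rcases Nat.lt_or_eq_of_le hm with hm | rfl
    · apply hnj' (k - 1 - m) (by omega)
      rw [← he]
      congr 1
      have e : ((k - 1 - m : ℕ) : ℤ) = k - 1 - m := by omega
      rw [e]; ring
    · exact hne he

/-- `w` is the period of `s`. -/
def Rep (w : List (Fin n)) (s : ℤ → Fin n) : Prop :=
  ∀ (k : ℕ) (h : k < w.length), w[k] = s k

theorem exists_rep (w : List (Fin n)) (hw : w.length = n.factorial) :
    ∃ s : ℤ → Fin n, (∀ i, s (i + (n.factorial : ℤ)) = s i) ∧ Rep w s := by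
  have fpos : 0 < (n.factorial : ℤ) := by exact_mod_cast n.factorial_pos
  have hb : ∀ i : ℤ, (i % (n.factorial : ℤ)).toNat < w.length := by
    intro i
    have h1 := Int.emod_nonneg i fpos.ne'
    have h2 := Int.emod_lt_of_pos i fpos
    omega
  refine ⟨fun i => w[(i % (n.factorial : ℤ)).toNat]'(hb i), ?_, ?_⟩
  · intro i
    simp
  · intro k h
    have : ((k : ℤ) % (n.factorial : ℤ)).toNat = k := by
      rw [Int.emod_eq_of_lt (by omega) (by omega)]; simp
    simp only [this]

theorem Rep.reverse {w : List (Fin n)} (hw : w.length = n.factorial)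
    (per : ∀ i, s (i + (n.factorial : ℤ)) = s i) (h : Rep w s) :
    Rep w.reverse (fun i => s (-1 - i)) := by
  intro k hk
  rw [List.length_reverse] at hk
  rw [List.getElem_reverse, h]
  apply per_dvd per
  refine ⟨1, ?_⟩
  omega

theorem Rep.conj {w₁ w₂ : List (Fin n)} (hw : (w₁ ++ w₂).length = n.factorial)
    (per : ∀ i, s (i + (n.factorial : ℤ)) = s i) (h : Rep (w₁ ++ w₂) s) :
    Rep (w₂ ++ w₁) (fun i => s (w₁.length + i)) := by
  intro k hk
  rw [List.length_append] at hk hw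
  rw [List.getElem_append]
  split_ifs with h1
  · have := h (w₁.length + k) (by rw [List.length_append]; omega)
    rw [List.getElem_append_right (by omega)] at this
    simp only [Nat.add_sub_cancel_left] at this
    rw [this]; push_cast; rfl
  · have := h (k - w₂.length) (by rw [List.length_append]; omega)
    rw [List.getElem_append_left (by omega)] at this
    rw [this]
    apply per_dvd per
    refine ⟨-1, ?_⟩
    omega

theorem lex_iff (r : Fin n → Fin n → Prop) (u v : List (Fin n)) (h : u.length = v.length) :
    List.Lex r u v ↔ ∃ (k : ℕ) (h1 : k < u.length) (h2 : k < v.length),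
      (∀ (l : ℕ) (hl : l < k), u[l] = v[l]) ∧ r u[k] v[k] := by
  induction u generalizing v with
  | nil =>
    cases v with
    | nil => simp
    | cons b v => simp at h
  | cons a u ih =>
    cases v with
    | nil => simp at h
    | cons b v =>
      have hh : u.length = v.length := by simpa using h
      constructor
      · intro hl
        cases hl with
        | rel hr => exact ⟨0, by simp, by simp, by simp, by simpa using hr⟩
        | cons hl =>
          obtain ⟨k, h1, h2, h3, h4⟩ := (ih v hh).1 hl
          refine ⟨k + 1, by simpa using h1, by simpa using h2, ?_, by simpa using h4⟩
          intro l hl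
          rcases l with _ | l
          · simp
          · simpa using h3 l (by omega)
      · rintro ⟨k, h1, h2, h3, h4⟩
        rcases k with _ | k
        · exact List.Lex.rel (by simpa using h4)
        · have h0 := h3 0 (by omega)
          simp only [List.getElem_cons_zero] at h0
          subst h0
          apply List.Lex.cons
          refine (ih v hh).2 ⟨k, by simpa using h1, by simpa using h2, ?_, by simpa using h4⟩
          intro l hl
          simpa using h3 (l + 1) (by omega)

theorem lex_rep (r : Fin n → Fin n → Prop) {w₁ w₂ : List (Fin n)}
    (hw : (w₁ ++ w₂).length = n.factorial)
    (per : ∀ i, s (i + (n.factorial : ℤ)) = s i) (h : Rep (w₁ ++ w₂) s) :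
    List.Lex r (w₁ ++ w₂) (w₂ ++ w₁) ↔ ∃ k : ℕ, k < n.factorial ∧
      Ag s 0 w₁.length k ∧ r (s k) (s (w₁.length + k)) := by
  have h' := h.conj hw per
  have hlen : (w₂ ++ w₁).length = n.factorial := by
    rw [← hw, List.length_append, List.length_append, add_comm]
  rw [lex_iff r _ _ (hw.trans hlen.symm)]
  constructor
  · rintro ⟨k, h1, h2, h3, h4⟩
    refine ⟨k, by omega, ?_, ?_⟩
    · intro l hl
      have := h3 l hl
      rw [h, h'] at this
      simpa using this
    · rwa [h, h'] at h4
  · rintro ⟨k, h1, h2, h3⟩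
    refine ⟨k, by omega, by omega, ?_, ?_⟩
    · intro l hl
      rw [h, h']
      simpa using h2 l hl
    · rwa [h, h']

theorem setup_of_ulw {w : List (Fin n)} (hw : IsULW n w)
    (per : ∀ i, s (i + (n.factorial : ℤ)) = s i) (h : Rep w s) : Setup n s := by
  have fpos : 0 < (n.factorial : ℤ) := by exact_mod_cast n.factorial_pos
  have main : ∀ i : ℤ, ∃ r : Fin n → Fin n → Prop, IsStrictTotalOrder (Fin n) r ∧
      ∀ j, ¬ (n.factorial : ℤ) ∣ i - j → ∃ k : ℕ, Ag s i j k ∧ r (s (i + k)) (s (j + k)) := by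
    intro i
    have hm0 := Int.emod_nonneg i fpos.ne'
    have hm1 := Int.emod_lt_of_pos i fpos
    obtain ⟨m, hm⟩ := Int.eq_ofNat_of_zero_le hm0
    have hmi : (n.factorial : ℤ) ∣ i - m := by
      rw [← hm]; exact Int.dvd_self_sub_emod
    have hlen := hw.1
    have hsplit : w = w.take m ++ w.drop m := (List.take_append_drop m w).symm
    have hl1 : (w.take m).length = m := by rw [List.length_take]; omega
    obtain ⟨r, hr, hL⟩ := hw.2 (w.drop m ++ w.take m) ⟨_, _, hsplit, rfl⟩
    refine ⟨r, hr, ?_⟩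
    rw [hsplit] at h hlen
    have h' := h.conj hlen per
    rw [hl1] at h'
    generalize hv : w.drop m ++ w.take m = v at *
    have hvlen : v.length = n.factorial := by
      rw [← hv, ← hlen, List.length_append, List.length_append, add_comm]
    intro j hj
    have ht0 := Int.emod_nonneg (j - i) fpos.ne'
    have ht1 := Int.emod_lt_of_pos (j - i) fpos
    obtain ⟨t, ht⟩ := Int.eq_ofNat_of_zero_le ht0
    have htj : (n.factorial : ℤ) ∣ (j - i) - t := by
      rw [← ht]; exact Int.dvd_self_sub_emod
    have htne : t ≠ 0 := by
      rintro rfl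
      apply hj
      have := (dvd_neg).2 htj
      simpa using this
    have hvs : v = v.take t ++ v.drop t := (List.take_append_drop t v).symm
    have hl2 : (v.take t).length = t := by rw [List.length_take]; omega
    have hlex := hL (v.take t) (v.drop t) hvs
      (by intro h0; rw [h0] at hl2; simp at hl2; omega)
      (by intro h0
          have : (v.drop t).length = 0 := by rw [h0]; rfl
          rw [List.length_drop] at this; omega)
    have hpp : ∀ x : ℤ, s ((m : ℤ) + (x + (n.factorial : ℤ))) = s ((m : ℤ) + x) := by
      intro x; rw [← add_assoc, per]
    nth_rw 1 [hvs] at hlex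
    rw [hvs] at h' hvlen
    obtain ⟨k, hk, hag, hrk⟩ := (lex_rep (s := fun i => s ((m : ℤ) + i)) r hvlen hpp h').1 hlex
    rw [hl2] at hag hrk
    have e1 : ∀ x : ℤ, s (i + x) = s (m + x) := fun x =>
      per_dvd per (by simpa using hmi)
    have e2 : ∀ x : ℤ, s (j + x) = s (m + (t + x)) := fun x =>
      per_dvd per (by
        have := dvd_add hmi htj
        rw [show i - (m : ℤ) + (j - i - t) = j + x - (m + (t + x)) by ring] at this
        exact this)
    refine ⟨k, ?_, ?_⟩
    · intro l hl
      rw [e1, e2]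
      simpa using hag l hl
    · rw [e1, e2]
      exact hrk
  refine ⟨per, ?_, ?_⟩
  · intro i j hij
    by_contra hd
    obtain ⟨r, hr, H⟩ := main i
    obtain ⟨k, -, hk⟩ := H j hd
    rw [hij (k + 1) k (by omega)] at hk
    exact irrefl_of r _ hk
  · intro i
    obtain ⟨r, hr, H⟩ := main i
    obtain ⟨σ, hσ⟩ := exists_rank r
    refine ⟨σ, ?_⟩
    intro j k hag hne
    have hd : ¬ (n.factorial : ℤ) ∣ i - j := fun hd =>
      hne (per_dvd per (by simpa using hd))
    obtain ⟨k', hag', hk'⟩ := H j hd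
    have hk : k' = k := by
      rcases lt_trichotomy k' k with hlt | heq | hlt
      · rw [hag k' hlt] at hk'
        exact absurd hk' (irrefl_of r _)
      · exact heq
      · exact absurd (hag' k hlt) hne
    subst hk
    exact (hσ _ _).1 hk'

theorem ulw_of_setup {w : List (Fin n)} (hw : w.length = n.factorial) (S : Setup n s)
    (h : Rep w s) : IsULW n w := by
  classical
  refine ⟨hw, ?_⟩
  rintro v ⟨w₁, w₂, rfl, rfl⟩
  have h' := h.conj hw S.per
  obtain ⟨σ, hσ⟩ := S.good w₁.length
  refine ⟨fun x y => σ x < σ y, ?_, ?_⟩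
  · exact
    { trichotomous := fun x y h1 h2 => σ.injective (le_antisymm (not_lt.1 h2) (not_lt.1 h1))
      irrefl := fun x => lt_irrefl _
      trans := fun x y z h1 h2 => lt_trans h1 h2 }
  · have hlen : (w₂ ++ w₁).length = n.factorial := by
      rw [← hw, List.length_append, List.length_append, add_comm]
    generalize (w₁.length : ℤ) = m at *
    generalize w₂ ++ w₁ = v at *
    rintro a b rfl ha hb
    have hpp : ∀ x : ℤ, s ((m : ℤ) + (x + (n.factorial : ℤ))) = s ((m : ℤ) + x) := by
      intro x; rw [← add_assoc, S.per]
    rw [lex_rep _ hlen hpp h']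
    have ha' := List.length_pos_iff.2 ha
    have hb' := List.length_pos_iff.2 hb
    rw [List.length_append] at hlen
    have hex : ∃ k : ℕ, s (m + k) ≠ s (m + a.length + k) := by
      by_contra hcon
      push Not at hcon
      have hd := S.prim m (m + a.length) (fun k l _ => hcon l)
      have := Int.eq_zero_of_abs_lt_dvd hd (by rw [abs_lt]; constructor <;> omega)
      omega
    have hag : Ag s m (m + a.length) (Nat.find hex) := fun l hl =>
      not_not.1 (Nat.find_min hex hl)
    refine ⟨Nat.find hex, ?_, ?_, ?_⟩
    · by_contra hge
      push Not at hge
      have hspec := Nat.find_spec hex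
      have hlt : Nat.find hex - n.factorial < Nat.find hex := by
        have := n.factorial_pos
        omega
      apply hspec
      have := hag _ hlt
      rw [Nat.cast_sub hge] at this
      rw [← S.per (m + _), ← S.per (m + a.length + _)] at this
      convert this using 2 <;> ring
    · intro l hl
      have := hag l hl
      simpa [add_assoc] using this
    · have := hσ _ _ hag (Nat.find_spec hex)
      simpa [add_assoc] using this

end

end ULW

/-- The reversal of a universal Lyndon word of degree `n` is a universal Lyndon word of
degree `n`. -/
theorem stmt_9 (n : ℕ) (w : List (Fin n)) (hw : IsULW n w) :
    IsULW n w.reverse := by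
  obtain ⟨s, per, hs⟩ := ULW.exists_rep w hw.1
  have S := ULW.setup_of_ulw hw per hs
  exact ULW.ulw_of_setup (by rw [List.length_reverse, hw.1]) S.reverse (hs.reverse hw.1 per)
end

section
/- Let w be a universal Lyndon word of degree n, let s be a word over Σ_n and let a ∈ Σ_n∖alp(s). If the word asa is a cyclic factor of w, then for every letter b ∈ Σ_n∖alp(s) the word bsb is a cyclic factor of w. -/
/-- Positions `i` and `j` of the cyclic word `W` carry the same factor of length `l`. -/
def Agr {n N : ℕ} (W : ZMod N → Fin n) (i j : ZMod N) (l : ℕ) : Prop :=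
  ∀ u : ℕ, u < l → W (i + u) = W (j + u)

/-- Position `i` is the strictly least conjugate for the order given by the key `f`. -/
def Lst {n N : ℕ} (W : ZMod N → Fin n) (f : Fin n → ℕ) (i : ZMod N) : Prop :=
  ∀ j, j ≠ i → ∃ t : ℕ, Agr W i j t ∧ f (W (i + t)) < f (W (j + t))

theorem Lst.cmp {n N : ℕ} {W : ZMod N → Fin n} {f : Fin n → ℕ} {i j : ZMod N} (h : Lst W f i)
    {l : ℕ} (ha : Agr W i j l) (hne : W (i + l) ≠ W (j + l)) : f (W (i + l)) < f (W (j + l)) := by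
  have hij : j ≠ i := by rintro rfl; exact hne rfl
  obtain ⟨t, h1, h2⟩ := h j hij
  rcases lt_trichotomy t l with h3 | h3 | h3
  · rw [ha t h3] at h2; exact absurd h2 (lt_irrefl _)
  · subst h3; exact h2
  · exact absurd (h1 l h3) hne

theorem Lst.uniq {n N : ℕ} {W : ZMod N → Fin n} {f : Fin n → ℕ} {i j : ZMod N} (h : Lst W f i)
    (h' : Lst W f j) : i = j := by
  by_contra hij
  obtain ⟨t, h1, h2⟩ := h j (Ne.symm hij)
  have := h'.cmp (l := t) (j := i) (fun u hu => (h1 u hu).symm)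
    (by intro h; rw [h] at h2; exact lt_irrefl _ h2)
  omega

/-- The abstract hypotheses extracted from a universal Lyndon word. -/
structure Good {n N : ℕ} (W : ZMod N → Fin n) : Prop where
  ord : ∀ i, ∃ f : Fin n → ℕ, Function.Injective f ∧ Lst W f i
  pos : ∀ f : Fin n → ℕ, Function.Injective f → ∃ i, Lst W f i
  eqv : ∀ (f g : Fin n → ℕ) (i : ZMod N), Function.Injective f → Function.Injective g →
    Lst W f i → Lst W g i → ∀ x y, f x < f y ↔ g x < g y

theorem Agr.symm {n N : ℕ} {W : ZMod N → Fin n} {i j : ZMod N} {l : ℕ} (h : Agr W i j l) :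
    Agr W j i l := fun u hu => (h u hu).symm

theorem Good.one {n N : ℕ} {W : ZMod N → Fin n} (hG : Good W) {i j : ZMod N} {l u : ℕ}
    (ha : Agr W i j l) (hu : u < l) (he : W (i + l) = W (i + u)) : W (j + l) = W (i + l) := by
  by_contra hne
  obtain ⟨f, -, hf⟩ := hG.ord (j + (u : ZMod N))
  obtain ⟨m, rfl⟩ := Nat.exists_eq_add_of_lt hu
  have e : ∀ k : ZMod N, k + u + ((m + 1 : ℕ) : ZMod N) = k + ((u + m + 1 : ℕ) : ZMod N) := by
    intro k; push_cast; ring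
  have h1 := hf.cmp (l := m + 1) (j := i + (u : ZMod N)) (by
    intro v hv
    have := ha (u + v) (by omega)
    push_cast at this
    simp only [add_assoc]
    exact this.symm) (by rw [e, e]; exact hne)
  rw [e, e] at h1
  have h2 := hf.cmp (l := 0) (j := j + ((u + m + 1 : ℕ) : ZMod N)) (by intro v hv; omega) (by
    rw [Nat.cast_zero, add_zero, add_zero, ← ha u hu, ← he]; exact fun h => hne h.symm)
  rw [Nat.cast_zero, add_zero, add_zero, ← ha u hu, ← he] at h2
  omega

theorem Good.two {n N : ℕ} {W : ZMod N → Fin n} (hG : Good W) {i : ZMod N} {l : ℕ}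
    (hc : ∀ u < l, W (i + (u : ℕ)) ≠ W (i + l)) (d : Fin n) (hd : ∀ u < l, W (i + (u : ℕ)) ≠ d) :
    ∃ j, Agr W i j l ∧ W (j + l) = d := by
  classical
  by_contra hno
  push Not at hno
  obtain ⟨τ, hτ, hi⟩ := hG.ord i
  set c := W (i + l) with hcdef
  have hcd : c ≠ d := hno i (fun _ _ => rfl)
  obtain ⟨B, hB⟩ : ∃ B, ∀ x, τ x < B :=
    ⟨∑ x, τ x + 1, fun x => Nat.lt_succ_of_le
      (Finset.single_le_sum (f := τ) (fun _ _ => Nat.zero_le _) (Finset.mem_univ x))⟩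
  let A : Fin n → Prop := fun x => ∃ u < l, W (i + (u : ℕ)) = x
  have hAc : ¬ A c := by rintro ⟨u, hu, h⟩; exact hc u hu h
  have hAd : ¬ A d := by rintro ⟨u, hu, h⟩; exact hd u hu h
  let f : Fin n → ℕ := fun x =>
    if A x then τ x else if x = d then B else if x = c then B + 1 else B + 2 + τ x
  let g : Fin n → ℕ := fun x =>
    if A x then τ x else if x = d then B + 1 else if x = c then B else B + 2 + τ x
  have hf : Function.Injective f := by
    intro x y h
    have := hB x
    have := hB y
    have := @hτ x y
    simp only [f] at h
    split_ifs at h <;> first | omega | (apply this; omega) | (subst_vars; rfl)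
  have hg : Function.Injective g := by
    intro x y h
    have := hB x
    have := hB y
    have := @hτ x y
    simp only [g] at h
    split_ifs at h <;> first | omega | (apply this; omega) | (subst_vars; rfl)
  obtain ⟨j, hj⟩ := hG.pos f hf
  have key : Agr W i j (l + 1) := by
    by_cases hji : i = j
    · subst hji; exact fun _ _ => rfl
    obtain ⟨t, h1, h2⟩ := hj i hji
    rcases lt_trichotomy t l with h3 | h3 | h3
    · exfalso
      have h4 := hi.cmp h1.symm (by intro h; rw [h] at h2; exact lt_irrefl _ h2)
      have h5 : A (W (i + t)) := ⟨t, h3, rfl⟩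
      have h6 := hB (W (i + t))
      simp only [f] at h2
      rw [if_pos h5] at h2
      split_ifs at h2 <;> omega
    · exfalso
      subst h3
      rw [← hcdef] at h2
      have h6 := hB (W (j + t))
      have h7 : W (j + t) ≠ d := hno j h1.symm
      have h8 : A (W (j + t)) := by
        by_contra h8
        simp only [f] at h2
        rw [if_neg h8, if_neg hAc, if_neg hcd, if_neg h7] at h2
        split_ifs at h2 <;> omega
      obtain ⟨u, hu, he⟩ := h8
      have := hG.one h1 hu (by rw [h1 u hu, he])
      rw [← hcdef] at this
      rw [this] at h2
      exact lt_irrefl _ h2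
    · exact fun u hu => (h1 u (by omega)).symm
  have hjg : Lst W g j := by
    intro j' hj'
    obtain ⟨t, h1, h2⟩ := hj j' hj'
    refine ⟨t, h1, ?_⟩
    have hx : ¬ (W (j + t) = d ∧ W (j' + t) = c) := by
      rintro ⟨hx, hy⟩
      rcases lt_trichotomy t l with h3 | h3 | h3
      · exact hd t h3 (by rw [key t (by omega), hx])
      · subst h3; exact hcd (by rw [hcdef, key t (by omega), hx])
      · have := hG.one h1.symm h3 (by rw [hy, ← h1 l h3, ← key l (by omega)])
        rw [hx, hy] at this
        exact hcd this.symm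
    have hB1 := hB (W (j + t))
    have hB2 := hB (W (j' + t))
    revert h2 hx hB1 hB2
    generalize W (j + t) = x
    generalize W (j' + t) = y
    intro h2 hx hB1 hB2
    simp only [f] at h2
    simp only [g]
    split_ifs at h2 ⊢ <;> first | omega | (exfalso; apply hx; constructor <;> assumption)
  have := (hG.eqv f g j hf hg hj hjg d c).1 (by
    simp only [f]; rw [if_neg hAc, if_neg hAd, if_neg hcd]; simp)
  simp only [g] at this
  rw [if_neg hAc, if_neg hAd, if_neg hcd] at this
  simp at this

theorem Good.main {n N : ℕ} [NeZero N] {W : ZMod N → Fin n} (hG : Good W) (i₀ : ZMod N) (l : ℕ)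
    (a : Fin n) (h0 : W i₀ = a) (h1 : W (i₀ + 1 + l) = a)
    (hs : ∀ u < l, W (i₀ + 1 + (u : ℕ)) ≠ a) (b : Fin n) (hb : ∀ u < l, W (i₀ + 1 + (u : ℕ)) ≠ b) :
    ∃ k, W k = b ∧ W (k + 1 + l) = b ∧ Agr W (i₀ + 1) (k + 1) l := by
  classical
  by_cases hab : b = a
  · subst hab; exact ⟨i₀, h0, h1, fun _ _ => rfl⟩
  have e : ∀ (k : ZMod N) (u : ℕ), k + ((u + 1 : ℕ) : ZMod N) = k + 1 + u := by
    intro k u; push_cast; ring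
  -- shifting
  have shift : ∀ {k k' : ZMod N} {m : ℕ}, W k = W k' → Agr W (k + 1) (k' + 1) m →
      Agr W k k' (m + 1) := by
    intro k k' m hk hA u hu
    rcases u with _ | u
    · simpa using hk
    · rw [e, e]; exact hA u (by omega)
  have unshift : ∀ {k k' : ZMod N} {m : ℕ}, Agr W k k' (m + 1) → Agr W (k + 1) (k' + 1) m := by
    intro k k' m hA u hu
    have := hA (u + 1) (by omega)
    rwa [e, e] at this
  let T : Finset (ZMod N) := Finset.univ.filter fun i => Agr W (i₀ + 1) i (l + 1)
  let T' : Finset (ZMod N) := Finset.univ.filter fun i => Agr W i₀ i (l + 1)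
  -- occurrences of `as` are followed by `a`
  have hasa : ∀ i, Agr W i₀ i (l + 1) → W (i + 1 + l) = a := by
    intro i hi
    have := hG.one hi (u := 0) (by omega) (by rw [e, h1]; simpa using h0.symm)
    rw [e, e, h1] at this
    exact this
  have hT'T : ∀ i ∈ T', i + 1 ∈ T := by
    intro i hi
    simp only [T', T, Finset.mem_filter, Finset.mem_univ, true_and] at hi ⊢
    intro u hu
    rcases Nat.lt_succ_iff_lt_or_eq.1 hu with hu | rfl
    · exact unshift hi u hu
    · rw [h1, hasa i hi]
  choose F hF hFL using hG.ord
  -- the order at an occurrence of `sa`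
  have hlow : ∀ i ∈ T, ∀ x, (∃ u < l, W (i₀ + 1 + (u : ℕ)) = x) → F i x < F i a := by
    intro i hi x hx
    simp only [T, Finset.mem_filter, Finset.mem_univ, true_and] at hi
    let m := Nat.find hx
    obtain ⟨hm, hmx⟩ : m < l ∧ W (i₀ + 1 + (m : ℕ)) = x := Nat.find_spec hx
    have hmin : ∀ u < m, W (i₀ + 1 + (u : ℕ)) ≠ x := fun u hu hux =>
      Nat.find_min hx hu ⟨by omega, hux⟩
    have hag : Agr W (i₀ + 1) i m := fun u hu => hi u (by omega)
    obtain ⟨j, hj1, hj2⟩ := hG.two (i := i) (l := m) (by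
      intro u hu
      rw [← hag u hu, ← hi m (by omega), hmx]; exact hmin u hu) a (by
      intro u hu; rw [← hag u hu]; exact hs u (by omega))
    have hxa : x ≠ a := by rw [← hmx]; exact hs m hm
    have := (hFL i).cmp hj1 (by rw [hj2, ← hi m (by omega), hmx]; exact hxa)
    rwa [hj2, ← hi m (by omega), hmx] at this
  have hhigh : ∀ i ∈ T, ∀ x, x ≠ a → (∀ u < l, W (i₀ + 1 + (u : ℕ)) ≠ x) → F i a < F i x := by
    intro i hi x hxa hx
    simp only [T, Finset.mem_filter, Finset.mem_univ, true_and] at hi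
    have hl := hi l (by omega)
    rw [h1] at hl
    obtain ⟨j, hj1, hj2⟩ := hG.two (i := i) (l := l) (by
      intro u hu
      rw [← hl, ← hi u (by omega)]; exact hs u hu) x (by
      intro u hu; rw [← hi u (by omega)]; exact hx u (by omega))
    have := (hFL i).cmp hj1 (by rw [hj2, ← hl]; exact hxa.symm)
    rwa [hj2, ← hl] at this
  let g : ZMod N → Fin n → ℕ := fun i x => if x = a then 0 else F i x + 1
  have hg : ∀ i, Function.Injective (g i) := by
    intro i x y h
    have := @hF i x y
    simp only [g] at h
    split_ifs at h <;> first | omega | (apply this; omega) | (subst_vars; rfl)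
  choose P hP using fun i => hG.pos (g i) (hg i)
  have hPT : ∀ i ∈ T, P i ∈ T' := by
    intro i hi
    simp only [T', T, Finset.mem_filter, Finset.mem_univ, true_and] at hi ⊢
    by_cases hne : i₀ = P i
    · rw [← hne]; exact fun _ _ => rfl
    obtain ⟨t, ht1, ht2⟩ := hP i i₀ hne
    by_cases htl : l + 1 ≤ t
    · exact fun u hu => (ht1 u (by omega)).symm
    exfalso
    rcases t with _ | t
    · simp [h0, g] at ht2
    rw [e, e] at ht2
    have hx : W (i₀ + 1 + t) ≠ a := hs t (by omega)
    have hya : W (P i + 1 + t) ≠ a := by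
      intro hy
      have hp0 := ht1 0 (by omega)
      simp only [Nat.cast_zero, add_zero] at hp0
      have := hG.one ht1 (u := 0) (by omega) (by rw [e, hy]; simp [hp0, h0])
      rw [e, e, hy] at this
      exact hx this
    simp only [g] at ht2
    rw [if_neg hx, if_neg hya] at ht2
    have hag := unshift ht1
    have hit := hi t (by omega)
    have := (hFL i).cmp (l := t) (j := P i + 1) (by
      intro u hu; rw [← hi u (by omega), hag u hu]) (by
      rw [← hit]; intro h; rw [h] at ht2; omega)
    rw [← hit] at this
    omega
  have hPinj : ∀ i ∈ T, ∀ i' ∈ T, P i = P i' → i = i' := by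
    intro i hi i' hi' hPP
    have h2 := hP i'
    rw [← hPP] at h2
    have hE := hG.eqv _ _ _ (hg i) (hg i') (hP i) h2
    have hE' : ∀ x y, F i x < F i y → F i' x < F i' y := by
      intro x y hxy
      have hxy' : x ≠ y := by rintro rfl; exact lt_irrefl _ hxy
      by_cases hx : x = a
      · subst hx
        apply hhigh i' hi' y hxy'.symm
        intro u hu huy
        have := hlow i hi y ⟨u, hu, huy⟩
        omega
      by_cases hy : y = a
      · subst hy
        apply hlow i' hi' x
        by_contra hcon
        have := hhigh i hi x hx (by
          intro u hu hux; exact hcon ⟨u, hu, hux⟩)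
        omega
      have := (hE x y).1 (by simp only [g]; rw [if_neg hx, if_neg hy]; omega)
      simp only [g] at this
      rw [if_neg hx, if_neg hy] at this
      omega
    have hL : Lst W (F i') i := by
      intro j hj
      obtain ⟨t, ht1, ht2⟩ := hFL i j hj
      exact ⟨t, ht1, hE' _ _ ht2⟩
    exact hL.uniq (hFL i')
  have hcard : T.card ≤ T'.card :=
    Finset.card_le_card_of_injOn P hPT (fun i hi i' hi' h => hPinj i hi i' hi' h)
  have himg : T'.image (· + 1) = T := by
    apply Finset.eq_of_subset_of_card_le
    · intro x hx
      obtain ⟨i, hi, rfl⟩ := Finset.mem_image.1 hx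
      exact hT'T i hi
    · rw [Finset.card_image_of_injective _ (add_left_injective 1)]
      exact hcard
  have hpred : ∀ j, j + 1 ∈ T → j ∈ T' := by
    intro j hj
    rw [← himg] at hj
    obtain ⟨i, hi, hij⟩ := Finset.mem_image.1 hj
    have : i = j := add_left_injective 1 hij
    rwa [← this]
  -- the final argument
  obtain ⟨j, hj1, hj2⟩ := hG.two (i := i₀ + 1) (l := l) (by rw [h1]; exact hs) b hb
  obtain ⟨k, rfl⟩ : ∃ k, j = k + 1 := ⟨j - 1, by ring⟩
  refine ⟨k, ?_, hj2, hj1⟩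
  by_contra hkb
  have hnew : ∀ u < l + 1, W (k + (u : ℕ)) ≠ b := by
    intro u hu
    rcases u with _ | u
    · simpa using hkb
    · rw [e, ← hj1 u (by omega)]; exact hb u (by omega)
  by_cases hka : W k = a
  · have := hasa k (shift (by rw [h0, hka]) hj1)
    rw [hj2] at this
    exact hab this
  · obtain ⟨j', hj'1, hj'2⟩ := hG.two (i := k) (l := l + 1) (by rw [e, hj2]; exact hnew) a (by
      intro u hu
      rcases u with _ | u
      · simpa using hka
      · rw [e, ← hj1 u (by omega)]; exact hs u (by omega))
    have hmem : j' ∈ T' := by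
      apply hpred
      simp only [T, Finset.mem_filter, Finset.mem_univ, true_and]
      intro u hu
      rcases Nat.lt_succ_iff_lt_or_eq.1 hu with hu | rfl
      · rw [hj1 u hu, unshift hj'1 u hu]
      · rw [h1, ← e, hj'2]
    simp only [T', Finset.mem_filter, Finset.mem_univ, true_and] at hmem
    have q1 := hmem 0 (by omega)
    have q2 := hj'1 0 (by omega)
    simp only [Nat.cast_zero, add_zero] at q1 q2
    exact hka (by rw [q2, ← q1, h0])

theorem lex_split {α : Type*} {r : α → α → Prop} {l₁ l₂ : List α} (h : List.Lex r l₁ l₂) :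
    l₁.length = l₂.length → ∃ t : ℕ, ∃ h1 : t < l₁.length, ∃ h2 : t < l₂.length,
      (∀ u < t, l₁[u]? = l₂[u]?) ∧ r l₁[t] l₂[t] := by
  induction h with
  | nil => intro h; simp at h
  | rel h => intro _; exact ⟨0, by simp, by simp, by simp, by simpa using h⟩
  | cons _ ih =>
    intro hl
    obtain ⟨t, h1, h2, h3, h4⟩ := ih (by simpa using hl)
    refine ⟨t + 1, by simpa using h1, by simpa using h2, ?_, by simpa using h4⟩
    intro u hu
    rcases u with _ | u
    · simp
    · simpa using h3 u (by omega)

theorem exists_equiv_of_lin {α : Type} [LinearOrder α] [Fintype α] {n : ℕ}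
    (h : Fintype.card α = n) : ∃ σ : α ≃ Fin n, ∀ x y, x < y → σ x < σ y :=
  ⟨(Fintype.orderIsoFinOfCardEq α h).symm.toEquiv,
    fun _ _ hxy => (Fintype.orderIsoFinOfCardEq α h).symm.lt_iff_lt.2 hxy⟩

theorem exists_perm_of_sto {n : ℕ} (r : Fin n → Fin n → Prop) (hr : IsStrictTotalOrder (Fin n) r) :
    ∃ σ : Equiv.Perm (Fin n), ∀ x y, r x y → σ x < σ y := by
  classical
  exact @exists_equiv_of_lin (Fin n) (linearOrderOfSTO r) _ n (by simp)

theorem exists_perm_of_key {n : ℕ} (f : Fin n → ℕ) (hf : Function.Injective f) :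
    ∃ σ : Equiv.Perm (Fin n), ∀ x y, f x < f y ↔ σ x < σ y := by
  obtain ⟨σ, hσ⟩ := exists_perm_of_sto (fun x y => f x < f y)
    { trichotomous := by intro x y h1 h2; apply hf; omega
      irrefl := by intro x; simp
      trans := by intro x y z h1 h2; omega }
  refine ⟨σ, fun x y => ⟨hσ x y, fun h => ?_⟩⟩
  by_contra hc
  rcases Nat.lt_or_ge (f y) (f x) with h1 | h1
  · exact absurd (hσ y x h1) (not_lt.2 h.le)
  · have : x = y := hf (by omega)
    subst this
    exact lt_irrefl _ h

theorem good_of_ord {n N : ℕ} [NeZero N] (hN : N = n.factorial) (W : ZMod N → Fin n)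
    (h : ∀ i, ∃ σ : Equiv.Perm (Fin n), Lst W (fun x => (σ x : ℕ)) i) : Good W := by
  classical
  choose S hS using h
  have hinj : Function.Injective S := by
    intro i j hij
    have := hS i
    rw [hij] at this
    exact this.uniq (hS j)
  have hbij : Function.Bijective S := by
    rw [Fintype.bijective_iff_injective_and_card]
    refine ⟨hinj, ?_⟩
    rw [ZMod.card, Fintype.card_perm, Fintype.card_fin, hN]
  have tr : ∀ (f : Fin n → ℕ), Function.Injective f → ∃ i, (∀ x y, f x < f y ↔ S i x < S i y) := by
    intro f hf
    obtain ⟨σ, hσ⟩ := exists_perm_of_key f hf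
    obtain ⟨i, rfl⟩ := hbij.2 σ
    exact ⟨i, hσ⟩
  have tr2 : ∀ (f : Fin n → ℕ) (i j : ZMod N), (∀ x y, f x < f y ↔ S i x < S i y) →
      Lst W f j → j = i := by
    intro f i j hf hj
    have : Lst W (fun x => (S i x : ℕ)) j := by
      intro k hk
      obtain ⟨t, h1, h2⟩ := hj k hk
      exact ⟨t, h1, (hf _ _).1 h2⟩
    exact this.uniq (hS i)
  refine ⟨fun i => ⟨_, ?_, hS i⟩, ?_, ?_⟩
  · intro x y hxy
    exact (S i).injective (Fin.ext hxy)
  · intro f hf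
    obtain ⟨i, hi⟩ := tr f hf
    refine ⟨i, fun k hk => ?_⟩
    obtain ⟨t, h1, h2⟩ := hS i k hk
    exact ⟨t, h1, (hi _ _).2 h2⟩
  · intro f g i hf hg h1 h2 x y
    obtain ⟨j, hj⟩ := tr f hf
    obtain ⟨k, hk⟩ := tr g hg
    have e1 := tr2 f j i hj h1
    have e2 := tr2 g k i hk h2
    subst e1
    subst e2
    rw [hj, hk]

/-- The cyclic word as a function on `ZMod |w|`. -/
def cyc {n : ℕ} (w : List (Fin n)) [NeZero w.length] : ZMod w.length → Fin n :=
  fun z => w[z.val]'(ZMod.val_lt z)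

theorem cyc_nat {n : ℕ} (w : List (Fin n)) [NeZero w.length] (m : ℕ) :
    cyc w (m : ZMod w.length) = w[m % w.length]'(Nat.mod_lt _ (NeZero.pos _)) := by
  simp only [cyc, ZMod.val_natCast]

theorem cyc_app {n : ℕ} (w : List (Fin n)) [NeZero w.length] (m : ℕ)
    (hm : m < (w ++ w).length) : (w ++ w)[m] = cyc w (m : ZMod w.length) := by
  rw [cyc_nat]
  rw [List.length_append] at hm
  rw [List.getElem_append]
  split_ifs with h
  · simp only [Nat.mod_eq_of_lt h]
  · have : m % w.length = m - w.length := by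
      rw [Nat.mod_eq_sub_mod (by omega), Nat.mod_eq_of_lt (by omega)]
    simp only [this]

theorem good_of_ulw {n : ℕ} (w : List (Fin n)) [NeZero w.length] (hw : IsULW n w) :
    Good (cyc w) := by
  apply good_of_ord hw.1
  intro i
  obtain ⟨r, hr, hL⟩ := hw.2 (w.rotate i.val) ⟨w.take i.val, w.drop i.val, by simp, by
    rw [List.rotate_eq_drop_append_take (ZMod.val_lt i).le]⟩
  obtain ⟨σ, hσ⟩ := exists_perm_of_sto r hr
  refine ⟨σ, fun j hj => ?_⟩
  set v := w.rotate i.val with hv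
  have hlen : v.length = w.length := by simp [hv]
  set m := (j - i).val with hm
  have hmlt : m < w.length := ZMod.val_lt _
  have hmpos : m ≠ 0 := by
    intro h
    rw [hm, ZMod.val_eq_zero, sub_eq_zero] at h
    exact hj h
  have hlex := hL (v.take m) (v.drop m) (by simp) (by
    intro h
    have := congrArg List.length h
    simp at this
    have hp : 0 < w.length := NeZero.pos _
    rcases this with h | h
    · exact hmpos h
    · rw [h] at hlen; simp at hlen; omega) (by
    intro h
    have := congrArg List.length h
    simp at this
    omega)
  rw [← List.rotate_eq_drop_append_take (by omega)] at hlex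
  obtain ⟨t, h1, h2, h3, h4⟩ := lex_split hlex (by simp)
  have g1 : ∀ u (hu : u < v.length), v[u] = cyc w (i + u) := by
    intro u hu
    have : i + (u : ZMod w.length) = ((u + i.val : ℕ) : ZMod w.length) := by
      push_cast; rw [ZMod.natCast_zmod_val]; ring
    rw [this, cyc_nat]
    simp only [hv, List.getElem_rotate]
  have g2 : ∀ u (hu : u < (v.rotate m).length), (v.rotate m)[u] = cyc w (j + u) := by
    intro u hu
    have : j + (u : ZMod w.length) = ((u + (i.val + m) : ℕ) : ZMod w.length) := by
      push_cast; rw [hm, ZMod.natCast_zmod_val, ZMod.natCast_zmod_val]; ring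
    rw [this, cyc_nat]
    simp only [hv, List.rotate_rotate, List.getElem_rotate]
  refine ⟨t, ?_, ?_⟩
  · intro u hu
    have := h3 u hu
    rw [List.getElem?_eq_getElem (by omega), List.getElem?_eq_getElem (by omega)] at this
    rw [← g1 u (by omega), ← g2 u (by omega)]
    exact Option.some.inj this
  · rw [g1, g2] at h4
    exact hσ _ _ h4

theorem cyc_factor {n : ℕ} (w u : List (Fin n)) [NeZero w.length] (k : ZMod w.length)
    (hu : u.length ≤ w.length) (h : ∀ t (ht : t < u.length), u[t] = cyc w (k + t)) :
    IsCyclicFactor w u := by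
  refine ⟨?_, hu⟩
  have hk := ZMod.val_lt k
  have : u = ((w ++ w).drop k.val).take u.length := by
    apply List.ext_getElem
    · simp; omega
    · intro t h1 h2
      rw [List.getElem_take, List.getElem_drop, cyc_app, h t h1]
      push_cast
      rw [ZMod.natCast_zmod_val]
  rw [this]
  exact (List.take_prefix _ _).isInfix.trans (List.drop_suffix _ _).isInfix

/-- Theorem: if `asa` is a cyclic factor of a ULW `w`, where the letter `a` does not occur
in `s`, then `bsb` is a cyclic factor of `w` for every letter `b` not occurring in `s`. -/
theorem stmt_14 (n : ℕ) (w s : List (Fin n)) (hw : IsULW n w)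
    (a : Fin n) (ha : a ∉ s) (h : IsCyclicFactor w (a :: (s ++ [a]))) :
    ∀ b : Fin n, b ∉ s → IsCyclicFactor w (b :: (s ++ [b])) := by
  intro b hb
  haveI : NeZero w.length := ⟨by rw [hw.1]; exact Nat.factorial_ne_zero n⟩
  have hG := good_of_ulw w hw
  obtain ⟨⟨l₁, l₂, hl⟩, hlen⟩ := h
  have hfac : ∀ t (ht : t < (a :: (s ++ [a])).length),
      (a :: (s ++ [a]))[t] = cyc w ((l₁.length : ZMod w.length) + t) := by
    intro t ht
    have hlt : l₁.length + t < (w ++ w).length := by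
      rw [← hl]; simp only [List.length_append]; omega
    have := cyc_app w (l₁.length + t) hlt
    push_cast at this
    rw [← this]
    simp only [← hl]
    rw [List.getElem_append_left (by simp only [List.length_append]; omega),
      List.getElem_append_right (by omega)]
    simp
  have e : ∀ (k : ZMod w.length) (u : ℕ), k + ((u + 1 : ℕ) : ZMod w.length) = k + 1 + u := by
    intro k u; push_cast; ring
  have hs : ∀ u (hu : u < s.length), cyc w ((l₁.length : ZMod w.length) + 1 + (u : ℕ)) = s[u] := by
    intro u hu
    have := hfac (u + 1) (by simp; omega)
    rw [e] at this
    rw [← this]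
    simp [List.getElem_append_left hu]
  obtain ⟨k, hk1, hk2, hk3⟩ := hG.main (l₁.length : ZMod w.length) s.length a
    (by have := hfac 0 (by simp); simpa using this.symm)
    (by
      have := hfac (s.length + 1) (by simp)
      rw [e] at this
      rw [← this]; simp)
    (by intro u hu; rw [hs u hu]; exact fun h => ha (h ▸ List.getElem_mem hu)) b
    (by intro u hu; rw [hs u hu]; exact fun h => hb (h ▸ List.getElem_mem hu))
  apply cyc_factor w _ k (by simpa using hlen)
  intro t ht
  rcases t with _ | t
  · simp [hk1]
  · rw [e]
    simp only [List.length_cons, List.length_append, List.length_nil] at ht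
    rw [List.getElem_cons_succ]
    by_cases hts : t < s.length
    · rw [List.getElem_append_left hts, ← hk3 t hts, hs t hts]
    · have : t = s.length := by omega
      subst this
      rw [hk2]; simp
end
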